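/- The maximum over odd n ≥ k of 2·C(n,(n-k)/2)/2^n equals 2^{1-k^2}·C(k^2, (k^2-k)/2), attained at n = k^2 - 2 and n = k^2. In particular for k = 3 the maximum trefoil probability among foils is 2^{-8}·C(9,3) = 21/64 = 0.328125. -/

import Mathlib

/-- The probability that the free `(k + 2m)`-foil produces a `k`-foil. -/
noncomputable def foilProb (k m : ℕ) : ℝ :=
  2 * ((k + 2 * m).choose m : ℝ) / 2 ^ (k + 2 * m)

theorem foilProb_nonneg (k m : ℕ) : 0 ≤ foilProb k m := by
  unfold foilProb
  positivity

theorem choose_add_two_mul_succ (k m : ℕ) :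
    (k + 2 * (m + 1)).choose (m + 1) * ((m + 1) * (k + m + 1)) =
      (k + 2 * m + 2) * (k + 2 * m + 1) * (k + 2 * m).choose m := by
  have h₁ := Nat.add_one_mul_choose_eq (k + 2 * m + 1) m
  have h₂ := Nat.choose_mul_succ_eq (k + 2 * m) m
  rw [show k + 2 * m + 1 - m = k + m + 1 by omega] at h₂
  rw [show k + 2 * (m + 1) = k + 2 * m + 1 + 1 by ring]
  calc
    _ = (k + 2 * m + 1 + 1).choose (m + 1) * (m + 1) * (k + m + 1) := by ring
    _ = (k + 2 * m + 2) * ((k + 2 * m + 1).choose m * (k + m + 1)) := by rw [← h₁]; ring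
    _ = _ := by rw [← h₂]; ring

theorem foilProb_succ_mul (k m : ℕ) :
    foilProb k (m + 1) * (4 * ((m + 1) * (k + m + 1))) =
      (k + 2 * m + 2) * (k + 2 * m + 1) * foilProb k m := by
  have h : ((k + 2 * (m + 1)).choose (m + 1) : ℝ) * ((m + 1) * (k + m + 1)) =
      (k + 2 * m + 2) * (k + 2 * m + 1) * (k + 2 * m).choose m := by
    exact_mod_cast choose_add_two_mul_succ k m
  have hpow : (2 : ℝ) ^ (k + 2 * (m + 1)) = 4 * 2 ^ (k + 2 * m) := by ring
  unfold foilProb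
  rw [hpow]
  field_simp
  linear_combination h

/-- The sign of each increment of `foilProb k` is that of `k ^ 2 - (k + 2 * m + 2)`. -/
theorem foilProb_succ_sub_mul (k m : ℕ) :
    (foilProb k (m + 1) - foilProb k m) * (4 * ((m + 1) * (k + m + 1))) =
      ((k : ℝ) ^ 2 - (k + 2 * m + 2)) * foilProb k m := by
  linear_combination foilProb_succ_mul k m

theorem foilProb_le_succ {k m : ℕ} (h : k + 2 * m + 2 ≤ k ^ 2) :
    foilProb k m ≤ foilProb k (m + 1) := by
  have h' : (k + 2 * m + 2 : ℝ) ≤ (k : ℝ) ^ 2 := by exact_mod_cast h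
  have hmul := mul_nonneg (sub_nonneg.2 h') (foilProb_nonneg k m)
  rw [← foilProb_succ_sub_mul] at hmul
  exact sub_nonneg.1 (nonneg_of_mul_nonneg_left hmul (by positivity))

theorem foilProb_succ_le {k m : ℕ} (h : k ^ 2 ≤ k + 2 * m + 2) :
    foilProb k (m + 1) ≤ foilProb k m := by
  have h' : (k : ℝ) ^ 2 ≤ (k + 2 * m + 2 : ℝ) := by exact_mod_cast h
  have hmul := mul_nonpos_of_nonpos_of_nonneg (sub_nonpos.2 h') (foilProb_nonneg k m)
  rw [← foilProb_succ_sub_mul] at hmul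
  exact sub_nonpos.1 (nonpos_of_mul_nonpos_left hmul (by positivity))

theorem foilProb_le_of_sq_eq {k M : ℕ} (hM : k ^ 2 = k + 2 * M) (m : ℕ) :
    foilProb k m ≤ foilProb k M := by
  rcases le_total m M with hm | hm
  · induction hm using Nat.decreasingInduction with
    | self => exact le_rfl
    | of_succ m hm ih => exact (foilProb_le_succ (by omega)).trans ih
  · induction m, hm using Nat.le_induction with
    | base => exact le_rfl
    | succ m hm ih => exact (foilProb_succ_le (by omega)).trans ih

/-- The maximum over odd `n ≥ k` of `2·C(n,(n-k)/2)/2^n` equals `2^{1-k²}·C(k²,(k²-k)/2)`,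
attained at `n = k² - 2` and `n = k²`; in particular for `k = 3` the maximum trefoil
probability among foils is `2^{-8}·C(9,3) = 21/64`. -/
theorem kfoil_prob_max (k : ℕ) (hk : Odd k) (hk3 : 3 ≤ k) :
    (∀ n : ℕ, Odd n → k ≤ n →
      (2 * (n.choose ((n - k) / 2)) : ℝ) / 2 ^ n ≤
        (2 : ℝ) ^ ((1 : ℤ) - (k : ℤ) ^ 2) * ((k ^ 2).choose ((k ^ 2 - k) / 2))) ∧
    (2 * ((k ^ 2 - 2).choose ((k ^ 2 - 2 - k) / 2)) : ℝ) / 2 ^ (k ^ 2 - 2) =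
      (2 : ℝ) ^ ((1 : ℤ) - (k : ℤ) ^ 2) * ((k ^ 2).choose ((k ^ 2 - k) / 2)) ∧
    (2 * ((k ^ 2).choose ((k ^ 2 - k) / 2)) : ℝ) / 2 ^ (k ^ 2) =
      (2 : ℝ) ^ ((1 : ℤ) - (k : ℤ) ^ 2) * ((k ^ 2).choose ((k ^ 2 - k) / 2)) ∧
    (2 : ℝ) ^ ((1 : ℤ) - (3 : ℤ) ^ 2) * ((9 : ℕ).choose 3) = 21 / 64 := by
  obtain ⟨j, rfl⟩ := hk
  generalize hk' : 2 * j + 1 = k at hk3 ⊢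
  obtain ⟨M, hM⟩ : ∃ M, k ^ 2 = k + 2 * (M + 1) := by
    refine ⟨j * (2 * j + 1) - 1, ?_⟩
    have hj : 1 ≤ j * (2 * j + 1) := Nat.mul_pos (by omega) (by omega)
    rw [Nat.sub_add_cancel hj, ← hk']
    ring
  have hmax : (2 : ℝ) ^ ((1 : ℤ) - (k : ℤ) ^ 2) * ((k ^ 2).choose ((k ^ 2 - k) / 2)) =
      foilProb k (M + 1) := by
    have hMz : (k : ℤ) ^ 2 = ((k + 2 * (M + 1) : ℕ) : ℤ) := by exact_mod_cast hM
    rw [hMz, zpow_sub₀ two_ne_zero, zpow_one, zpow_natCast, hM,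
      show (k + 2 * (M + 1) - k) / 2 = M + 1 by omega, foilProb]
    ring
  rw [hmax]
  refine ⟨fun n hn hkn => ?_, ?_, ?_, ?_⟩
  · obtain ⟨i, rfl⟩ := hn
    obtain ⟨m, hm⟩ : ∃ m, 2 * i + 1 = k + 2 * m := ⟨i - j, by omega⟩
    rw [hm, show (k + 2 * m - k) / 2 = m by omega]
    exact foilProb_le_of_sq_eq hM m
  · rw [show k ^ 2 - 2 = k + 2 * M by omega, show (k + 2 * M - k) / 2 = M by omega]
    exact (foilProb_le_succ (by omega)).antisymm (foilProb_succ_le (by omega))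
  · rw [hM, show (k + 2 * (M + 1) - k) / 2 = M + 1 by omega, foilProb]
  · norm_num [Nat.choose]
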